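/- Fixed points of the CACTO iteration are optimal: in the CACTO iteration, if for some k ∈ ℕ the value functions coincide, V^{TO(π^{k+1})}_t(x) = V^{TO(π^k)}_t(x) for all t and x, then V^{TO(π^k)} satisfies Bellman's optimality equation and hence V^{TO(π^k)}_t(x) = V*_t(x) for all t and x. -/

import Mathlib

/-- Value function of a policy `π`, defined by backward recursion:
`V^π_T(x) = lT x` and for `t < T`,
`V^π_t(x) = l t x (π t x) + V^π_{t+1}(f t x (π t x))`. -/
def val {S U : Type*} (T : ℕ) (f : Fin T → S → U → S) (l : Fin T → S → U → ℝ)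
    (lT : S → ℝ) (π : Fin T → S → U) : Fin (T + 1) → S → ℝ
  | t, x =>
    if h : (t : ℕ) < T then
      l ⟨t, h⟩ x (π ⟨t, h⟩ x) +
        val T f l lT π ⟨(t : ℕ) + 1, by omega⟩ (f ⟨t, h⟩ x (π ⟨t, h⟩ x))
    else lT x
  termination_by t _ => T - (t : ℕ)
  decreasing_by omega

/-- `π'` is greedy with respect to `W`. -/
def IsGreedy {S U : Type*} (T : ℕ) (f : Fin T → S → U → S) (l : Fin T → S → U → ℝ)
    (π' : Fin T → S → U) (W : Fin (T + 1) → S → ℝ) : Prop :=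
  ∀ (t : Fin T) (x : S) (u : U),
    l t x (π' t x) + W t.succ (f t x (π' t x)) ≤ l t x u + W t.succ (f t x u)

/-- The optimal value function: pointwise minimum of `val` over all (finitely many) policies. -/
noncomputable def optVal {S U : Type*} [Fintype S] [DecidableEq S] [Fintype U] [Nonempty U]
    (T : ℕ) (f : Fin T → S → U → S) (l : Fin T → S → U → ℝ) (lT : S → ℝ) :
    Fin (T + 1) → S → ℝ :=
  fun t x =>
    Finset.univ.inf' Finset.univ_nonempty (fun π : Fin T → S → U => val T f l lT π t x)

theorem val_last {S U : Type*} {T : ℕ} (f : Fin T → S → U → S) (l : Fin T → S → U → ℝ)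
    (lT : S → ℝ) (π : Fin T → S → U) (x : S) :
    val T f l lT π (Fin.last T) x = lT x := by
  rw [val]
  simp

theorem val_castSucc {S U : Type*} {T : ℕ} (f : Fin T → S → U → S) (l : Fin T → S → U → ℝ)
    (lT : S → ℝ) (π : Fin T → S → U) (t : Fin T) (x : S) :
    val T f l lT π t.castSucc x =
      l t x (π t x) + val T f l lT π t.succ (f t x (π t x)) := by
  rw [val, dif_pos (show (t.castSucc : ℕ) < T from t.isLt)]
  rfl

/-- Policy improvement: a policy that is greedy with respect to the value function of `p`
does at least as well as `p`. -/
theorem IsGreedy.val_le_val {S U : Type*} {T : ℕ} {f : Fin T → S → U → S}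
    {l : Fin T → S → U → ℝ} {lT : S → ℝ} {π' p : Fin T → S → U}
    (h : IsGreedy T f l π' (val T f l lT p)) (t : Fin (T + 1)) (x : S) :
    val T f l lT π' t x ≤ val T f l lT p t x := by
  induction t using Fin.reverseInduction generalizing x with
  | last => rw [val_last, val_last]
  | cast t ih =>
    rw [val_castSucc, val_castSucc]
    exact (add_le_add_right (ih _) _).trans (h t x _)

/-- A function that lies below its Bellman backup for every control is a lower bound for the
value function of every policy. -/
theorem le_val_of_le_backup {S U : Type*} {T : ℕ} {f : Fin T → S → U → S}
    {l : Fin T → S → U → ℝ} {lT : S → ℝ} {W : Fin (T + 1) → S → ℝ}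
    (hlast : ∀ x, W (Fin.last T) x ≤ lT x)
    (hstep : ∀ (t : Fin T) (x : S) (u : U), W t.castSucc x ≤ l t x u + W t.succ (f t x u))
    (p : Fin T → S → U) (t : Fin (T + 1)) (x : S) :
    W t x ≤ val T f l lT p t x := by
  induction t using Fin.reverseInduction generalizing x with
  | last => exact (hlast x).trans_eq (val_last f l lT p x).symm
  | cast t ih =>
    rw [val_castSucc]
    exact (hstep t x (p t x)).trans (add_le_add_right (ih _) _)

variable {S U : Type*} [Fintype S] [DecidableEq S] [Nonempty S] [Fintype U] [Nonempty U]
  (T : ℕ) (f : Fin T → S → U → S) (l : Fin T → S → U → ℝ) (lT : S → ℝ)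

theorem cacto_fixed_point_optimal
    (TO : (Fin T → S → U) → (Fin T → S → U))
    (hTO : ∀ (p : Fin T → S → U) (t : Fin (T + 1)) (x : S),
      val T f l lT (TO p) t x ≤ val T f l lT p t x)
    (π : ℕ → Fin T → S → U)
    (hgreedy : ∀ k : ℕ, IsGreedy T f l (π (k + 1)) (val T f l lT (TO (π k))))
    (k : ℕ)
    (hfix : ∀ (t : Fin (T + 1)) (x : S),
      val T f l lT (TO (π (k + 1))) t x = val T f l lT (TO (π k)) t x) :
    ((∀ x : S, val T f l lT (TO (π k)) (Fin.last T) x = lT x) ∧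
      ∀ (t : Fin T) (x : S),
        val T f l lT (TO (π k)) t.castSucc x =
          Finset.univ.inf' Finset.univ_nonempty
            (fun u : U => l t x u + val T f l lT (TO (π k)) t.succ (f t x u))) ∧
    ∀ (t : Fin (T + 1)) (x : S),
      val T f l lT (TO (π k)) t x = optVal T f l lT t x := by
  have hval : ∀ (t : Fin (T + 1)) (x : S),
      val T f l lT (TO (π k)) t x = val T f l lT (π (k + 1)) t x := fun t x =>
    le_antisymm ((hfix t x).symm.trans_le (hTO (π (k + 1)) t x)) ((hgreedy k).val_le_val t x)
  have hstep : ∀ (t : Fin T) (x : S), val T f l lT (TO (π k)) t.castSucc x =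
      l t x (π (k + 1) t x) +
        val T f l lT (TO (π k)) t.succ (f t x (π (k + 1) t x)) := fun t x => by
    rw [hval, val_castSucc, hval]
  have hle : ∀ (t : Fin T) (x : S) (u : U), val T f l lT (TO (π k)) t.castSucc x ≤
      l t x u + val T f l lT (TO (π k)) t.succ (f t x u) := fun t x u =>
    (hstep t x).trans_le (hgreedy k t x u)
  refine ⟨⟨val_last f l lT _, fun t x => le_antisymm ?_ ?_⟩, fun t x => le_antisymm ?_ ?_⟩
  · exact Finset.le_inf' _ _ fun u _ => hle t x u
  · rw [hstep]
    exact Finset.inf'_le (fun u : U => l t x u + val T f l lT (TO (π k)) t.succ (f t x u))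
      (Finset.mem_univ _)
  · exact Finset.le_inf' _ _ fun p _ =>
      le_val_of_le_backup (fun y => (val_last f l lT _ y).le) hle p t x
  · exact Finset.inf'_le (fun p : Fin T → S → U => val T f l lT p t x) (Finset.mem_univ _)
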